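/- arXiv:1602.01023 — 2 statements merged into one kernel-verified Lean document; each statement's English description precedes it below -/
import Mathlib

section
/- Let α > 1/2 and β > -1. Then max_{θ ∈ [0, π/2]} sin(θ/2) |P_n^{(α,β)}(cos θ)| ≲ n^{α-1} as n → ∞; that is, there exist C > 0 and n₀ such that sin(θ/2) |P_n^{(α,β)}(cos θ)| ≤ C n^{α-1} for all θ ∈ [0, π/2] and all n ≥ n₀. -/
open Real Set

/-- Jacobi polynomial `P_n^{(a,b)}` in the standard normalization. -/
noncomputable def jacobiP (a b : ℝ) (n : ℕ) (x : ℝ) : ℝ :=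
  (Nat.factorial n : ℝ)⁻¹ *
    ∑ k ∈ Finset.range (n + 1),
      (Nat.choose n k : ℝ) * (ascPochhammer ℝ k).eval ((n : ℝ) + a + b + 1) *
        (ascPochhammer ℝ (n - k)).eval (a + (k : ℝ) + 1) * ((x - 1) / 2) ^ k

/-- Pochhammer symbol `(q)_n` for real `q`. -/
noncomputable def poch (q : ℝ) (n : ℕ) : ℝ := (ascPochhammer ℝ n).eval q

/-- Coefficient of `(-s) ^ k` in `jacobiP a b n (1 - 2 * s)`. -/
noncomputable def jacobiCoeff (a b : ℝ) (n k : ℕ) : ℝ :=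
  (Nat.factorial n : ℝ)⁻¹ * ((Nat.choose n k : ℝ) * (ascPochhammer ℝ k).eval ((n : ℝ) + a + b + 1) *
    (ascPochhammer ℝ (n - k)).eval (a + (k : ℝ) + 1))

theorem jacobiCoeff_eq_zero (a b : ℝ) {n k : ℕ} (h : n < k) : jacobiCoeff a b n k = 0 := by
  simp [jacobiCoeff, Nat.choose_eq_zero_of_lt h]

theorem jacobiCoeff_succ (a b : ℝ) (n k : ℕ) :
    jacobiCoeff a b n (k + 1) * ((k + 1) * (a + k + 1)) =
      jacobiCoeff a b n k * ((n - k) * (n + a + b + 1 + k)) := by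
  rcases lt_trichotomy n k with h | rfl | h
  · simp [jacobiCoeff_eq_zero a b h, jacobiCoeff_eq_zero a b (Nat.lt_succ_of_lt h)]
  · simp [jacobiCoeff_eq_zero a b (Nat.lt_succ_self n)]
  · obtain ⟨m, rfl⟩ : ∃ m, n = k + (m + 1) := ⟨n - k - 1, by omega⟩
    have hchoose : ((k + (m + 1)).choose (k + 1) : ℝ) * (k + 1) =
        (k + (m + 1)).choose k * (m + 1) := by
      have := Nat.choose_succ_right_eq (k + (m + 1)) k
      rw [Nat.add_sub_cancel_left] at this
      exact_mod_cast this
    have hleft : (ascPochhammer ℝ (m + 1)).eval (a + (k : ℝ) + 1) =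
        (a + k + 1) * (ascPochhammer ℝ m).eval (a + (k + 1 : ℕ) + 1) := by
      rw [ascPochhammer_succ_left]
      simp [Polynomial.eval_comp, add_assoc, add_comm, add_left_comm]
    have hsub : k + (m + 1) - (k + 1) = m := by omega
    simp only [jacobiCoeff, hsub, Nat.add_sub_cancel_left, ascPochhammer_succ_eval, hleft]
    push_cast
    linear_combination (((k + (m + 1)).factorial : ℝ)⁻¹ *
      (ascPochhammer ℝ k).eval ((k + (m + 1) : ℝ) + a + b + 1) * (k + (m + 1) + a + b + 1 + k) *
      (a + k + 1) * (ascPochhammer ℝ m).eval (a + (k + 1 : ℝ) + 1)) * hchoose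

theorem jacobiCoeff_zero (a b : ℝ) (n : ℕ) :
    jacobiCoeff a b n 0 = (Nat.factorial n : ℝ)⁻¹ * (ascPochhammer ℝ n).eval (a + 1) := by
  simp [jacobiCoeff]

theorem jacobiCoeff_nonneg {a b : ℝ} (ha : 0 ≤ a + 1) (hab : 0 ≤ a + b + 1) (n k : ℕ) :
    0 ≤ jacobiCoeff a b n k := by
  have nonneg (m : ℕ) {q : ℝ} (hq : 0 ≤ q) : 0 ≤ (ascPochhammer ℝ m).eval q := by
    induction m with
    | zero => simp
    | succ m ih => rw [ascPochhammer_succ_eval]; positivity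
  have h₁ := nonneg k (q := n + a + b + 1) (by have := n.cast_nonneg (α := ℝ); linarith)
  have h₂ := nonneg (n - k) (q := a + k + 1) (by have := k.cast_nonneg (α := ℝ); linarith)
  unfold jacobiCoeff
  positivity

theorem jacobiCoeff_le {a b M : ℝ} (ha : 0 ≤ a) (hab : 0 ≤ a + b + 1) (n : ℕ)
    (hM : n * (n + a + b + 1) ≤ M) (k : ℕ) :
    jacobiCoeff a b n k ≤ jacobiCoeff a b n 0 * (M ^ k / Nat.factorial k) := by
  have hn : (0 : ℝ) ≤ n := n.cast_nonneg
  have hM₀ : 0 ≤ M := le_trans (mul_nonneg hn (by linarith)) hM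
  induction k with
  | zero => simp
  | succ k ih =>
    have hk : (0 : ℝ) ≤ k := k.cast_nonneg
    have hc := jacobiCoeff_nonneg (by linarith) hab n k
    have hc' := jacobiCoeff_nonneg (by linarith : 0 ≤ a + 1) hab n (k + 1)
    have hstep : jacobiCoeff a b n (k + 1) * (k + 1) ≤ jacobiCoeff a b n k * M := by
      calc jacobiCoeff a b n (k + 1) * (k + 1)
          ≤ jacobiCoeff a b n (k + 1) * ((k + 1) * (a + k + 1)) := by
            gcongr
            nlinarith
        _ = jacobiCoeff a b n k * ((n - k) * (n + a + b + 1 + k)) := jacobiCoeff_succ a b n k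
        _ ≤ jacobiCoeff a b n k * M := by
            gcongr
            nlinarith [mul_nonneg hk hab]
    rw [Nat.factorial_succ]
    push_cast
    calc jacobiCoeff a b n (k + 1) ≤ jacobiCoeff a b n k * M / (k + 1) := by
          rwa [le_div_iff₀ (by positivity)]
      _ ≤ jacobiCoeff a b n 0 * (M ^ k / Nat.factorial k) * M / (k + 1) := by gcongr
      _ = _ := by field_simp; ring

/-- The polynomial `jacobiP a b n (1 - 2 * s)` in the variable `s`. -/
noncomputable def jacobiPoly (a b : ℝ) (n : ℕ) : Polynomial ℝ :=
  ∑ k ∈ Finset.range (n + 1), Polynomial.monomial k (jacobiCoeff a b n k * (-1) ^ k)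

theorem jacobiPoly_coeff (a b : ℝ) (n k : ℕ) :
    (jacobiPoly a b n).coeff k = jacobiCoeff a b n k * (-1) ^ k := by
  simp only [jacobiPoly, Polynomial.finsetSum_coeff, Polynomial.coeff_monomial]
  rw [Finset.sum_ite_eq' (Finset.range (n + 1)) k]
  split_ifs with h
  · rfl
  · rw [jacobiCoeff_eq_zero a b (by simpa using h), zero_mul]

theorem eval_jacobiPoly (a b : ℝ) (n : ℕ) (s : ℝ) :
    (jacobiPoly a b n).eval s =
      ∑ k ∈ Finset.range (n + 1), jacobiCoeff a b n k * (-1) ^ k * s ^ k := by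
  simp [jacobiPoly, Polynomial.eval_finsetSum]

theorem eval_derivative_jacobiPoly (a b : ℝ) (n : ℕ) (s : ℝ) :
    s * (jacobiPoly a b n).derivative.eval s =
      ∑ k ∈ Finset.range (n + 1), k * (jacobiCoeff a b n k * (-1) ^ k * s ^ k) := by
  simp only [jacobiPoly, Polynomial.derivative_sum, Polynomial.derivative_monomial,
    Polynomial.eval_finsetSum, Polynomial.eval_monomial, Finset.mul_sum]
  refine Finset.sum_congr rfl fun k _ => ?_
  cases k with
  | zero => simp
  | succ k => simp only [Nat.add_sub_cancel]; ring

theorem jacobiP_one_sub_two_mul (a b : ℝ) (n : ℕ) (s : ℝ) :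
    jacobiP a b n (1 - 2 * s) = (jacobiPoly a b n).eval s := by
  rw [eval_jacobiPoly, jacobiP, Finset.mul_sum]
  refine Finset.sum_congr rfl fun k _ => ?_
  rw [show (1 - 2 * s - 1) / 2 = -1 * s by ring, mul_pow, jacobiCoeff]
  ring

open Polynomial in
theorem jacobiPoly_ode (a b : ℝ) (n : ℕ) (s : ℝ) :
    s * (1 - s) * (jacobiPoly a b n).derivative.derivative.eval s +
      (a + 1 - (a + b + 2) * s) * (jacobiPoly a b n).derivative.eval s +
      n * (n + a + b + 1) * (jacobiPoly a b n).eval s = 0 := by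
  set p := jacobiPoly a b n with hp
  have key : X * derivative (derivative p) - X * (X * derivative (derivative p)) +
      (C (a + 1) * derivative p - C (a + b + 2) * (X * derivative p)) +
      C (n * (n + a + b + 1) : ℝ) * p = 0 := by
    ext k
    have hrec := jacobiCoeff_succ a b n k
    rcases k with _ | _ | k
    all_goals
      simp only [coeff_add, coeff_sub, coeff_C_mul, coeff_X_mul, coeff_X_mul_zero,
        coeff_derivative, coeff_zero, hp, jacobiPoly_coeff]
      push_cast at hrec ⊢
    · linear_combination -hrec
    · linear_combination hrec
    · linear_combination (-(-1) ^ (k + 2)) * hrec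
  have h := congrArg (eval s) key
  simp only [eval_add, eval_sub, eval_mul, eval_X, eval_C, eval_zero] at h
  linear_combination h

/-- On the scale where `n * (n + a + b + 1) * s` stays bounded, the polynomial and its logarithmic
derivative are controlled by the value at `s = 0`. -/
theorem jacobiPoly_bounds {a b M s δ : ℝ} (ha : 0 ≤ a) (hab : 0 ≤ a + b + 1) (n : ℕ)
    (hM : n * (n + a + b + 1) ≤ M) (hs : 0 ≤ s) (hMs : M * s ≤ δ) :
    |(jacobiPoly a b n).eval s| ≤ jacobiCoeff a b n 0 * exp (2 * δ) ∧
      |s * (jacobiPoly a b n).derivative.eval s| ≤ jacobiCoeff a b n 0 * exp (2 * δ) := by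
  have hM₀ : 0 ≤ M := le_trans (mul_nonneg n.cast_nonneg
    (by have := n.cast_nonneg (α := ℝ); linarith)) hM
  have hδ : 0 ≤ δ := (mul_nonneg hM₀ hs).trans hMs
  have hc₀ := jacobiCoeff_nonneg (by linarith : 0 ≤ a + 1) hab n 0
  have term (k : ℕ) (r : ℝ) (hr : |r| ≤ 2 ^ k) :
      |r * (jacobiCoeff a b n k * (-1) ^ k * s ^ k)| ≤
        jacobiCoeff a b n 0 * ((2 * δ) ^ k / Nat.factorial k) := by
    have hc := jacobiCoeff_nonneg (by linarith : 0 ≤ a + 1) hab n k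
    rw [abs_mul, abs_mul, abs_mul, abs_of_nonneg hc, abs_pow, abs_neg, abs_one, one_pow, mul_one,
      abs_of_nonneg (pow_nonneg hs k)]
    calc |r| * (jacobiCoeff a b n k * s ^ k)
        ≤ 2 ^ k * (jacobiCoeff a b n 0 * (M ^ k / Nat.factorial k) * s ^ k) := by
          gcongr
          exact jacobiCoeff_le ha hab n hM k
      _ = jacobiCoeff a b n 0 * ((2 * (M * s)) ^ k / Nat.factorial k) := by
          rw [mul_pow, mul_pow]; ring
      _ ≤ _ := by gcongr
  have sum_le (r : ℕ → ℝ) (hr : ∀ k, |r k| ≤ 2 ^ k) :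
      |∑ k ∈ Finset.range (n + 1), r k * (jacobiCoeff a b n k * (-1) ^ k * s ^ k)| ≤
        jacobiCoeff a b n 0 * exp (2 * δ) := by
    refine (Finset.abs_sum_le_sum_abs _ _).trans
      ((Finset.sum_le_sum fun k _ => term k (r k) (hr k)).trans ?_)
    rw [← Finset.mul_sum]
    exact mul_le_mul_of_nonneg_left (Real.sum_le_exp_of_nonneg (by positivity) _) hc₀
  constructor
  · rw [eval_jacobiPoly]
    simpa using sum_le (fun _ => 1) fun k => by simpa using one_le_pow₀ (one_le_two (α := ℝ))
  · rw [eval_derivative_jacobiPoly]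
    refine sum_le (fun k => (k : ℝ)) fun k => ?_
    rw [Nat.abs_cast]
    exact_mod_cast Nat.lt_two_pow_self.le

/-- The normalization `P_n^{(a,b)}(1) = O(n ^ a)`. -/
theorem exists_jacobiCoeff_zero_le (a b : ℝ) (ha : 0 < a) :
    ∃ C : ℝ, 0 < C ∧ ∃ n₀ : ℕ, ∀ n : ℕ, n₀ ≤ n → jacobiCoeff a b n 0 ≤ C * (n : ℝ) ^ a := by
  have hΓ := Real.Gamma_pos_of_pos ha
  obtain ⟨n₀, hn₀⟩ := Filter.eventually_atTop.1
    ((Real.GammaSeq_tendsto_Gamma a).eventually_const_le (half_lt_self hΓ))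
  refine ⟨(a * (Real.Gamma a / 2))⁻¹, by positivity, n₀, fun n hn => ?_⟩
  have hseq := hn₀ n hn
  have hprod (m : ℕ) : ∏ j ∈ Finset.range (m + 1), (a + j) =
      a * (ascPochhammer ℝ m).eval (a + 1) := by
    induction m with
    | zero => simp
    | succ m ih =>
      rw [Finset.prod_range_succ, ih, ascPochhammer_succ_eval]
      push_cast
      ring
  have hpos : 0 < (ascPochhammer ℝ n).eval (a + 1) := ascPochhammer_pos n _ (by linarith)
  rw [Real.GammaSeq, hprod, le_div_iff₀ (by positivity)] at hseq
  rw [jacobiCoeff_zero, inv_mul_le_iff₀ (by positivity), mul_left_comm, le_inv_mul_iff₀ (by positivity)]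
  linarith

/-- A Sonin-type functional dominating `s * p(s) ^ 2` grows at most exponentially to the right of
the turning point `s = δ / M`. -/
theorem jacobiPoly_energy_bound {a b M t : ℝ} (ha : 1 / 2 < a) (n : ℕ)
    (hM : M = n * (n + a + b + 1) + (b + 1) / 2 + (a - 1 / 2) / 2) (hM₀ : 0 < M)
    (hst : (a - 1 / 2) / M ≤ t) (ht : t ≤ 1 / 2) :
    t * (jacobiPoly a b n).eval t ^ 2 ≤ exp |2 * b + 1| *
      ((a - 1 / 2) / M * (jacobiPoly a b n).eval ((a - 1 / 2) / M) ^ 2 +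
        2 / M * ((jacobiPoly a b n).eval ((a - 1 / 2) / M) / 2 +
          (a - 1 / 2) / M * (jacobiPoly a b n).derivative.eval ((a - 1 / 2) / M)) ^ 2) := by
  set p := jacobiPoly a b n with hp
  set δ := a - 1 / 2 with hδ
  have hδ₀ : 0 < δ := by rw [hδ]; linarith
  set s₁ := δ / M with hs₁
  have hs₁₀ : 0 < s₁ := by positivity
  set W : ℝ → ℝ := fun s => p.eval s / 2 + s * p.derivative.eval s with hW
  set D : ℝ → ℝ := fun s => M * s - δ / 2 with hD
  set F : ℝ → ℝ := fun s => s * p.eval s ^ 2 + s * (1 - s) * W s ^ 2 / D s with hF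
  set K : ℝ := 2 * |2 * b + 1| with hK
  have hDpos {s : ℝ} (hs : s₁ ≤ s) : 0 < D s := by
    have : δ ≤ M * s := by
      have := mul_le_mul_of_nonneg_left hs hM₀.le
      rwa [hs₁, mul_div_cancel₀ _ hM₀.ne'] at this
    simp only [hD]
    linarith
  have hderivF {s : ℝ} (hs : s₁ ≤ s) : HasDerivAt F
      (-(1 - s) * W s ^ 2 * (2 * D s * δ + δ / 2) / D s ^ 2 +
        (2 * b + 1) * s * W s ^ 2 / D s) s := by
    have hD' : D s ≠ 0 := (hDpos hs).ne'
    have h₀ := p.hasDerivAt s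
    have h₁ := p.derivative.hasDerivAt s
    have hWd : HasDerivAt W _ s := (h₀.div_const 2).add ((hasDerivAt_id s).mul h₁)
    have hDd : HasDerivAt D _ s := ((hasDerivAt_id s).const_mul M).sub_const (δ / 2)
    have hFd : HasDerivAt F _ s := ((hasDerivAt_id s).mul (h₀.pow 2)).add
      ((((hasDerivAt_id s).mul ((hasDerivAt_id s).const_sub 1)).mul (hWd.pow 2)).div hDd hD')
    refine hFd.congr_deriv ?_
    have hode : s * (1 - s) * p.derivative.derivative.eval s +
        (δ + 3 / 2 - (δ + b + 5 / 2) * s) * p.derivative.eval s +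
        (M - (b + 1) / 2 - δ / 2) * p.eval s = 0 := by
      rw [hM, hδ]
      linear_combination jacobiPoly_ode a b n s
    have hDs : D s = M * s - δ / 2 := rfl
    simp only [id, Pi.mul_apply, Pi.pow_apply, hW]
    generalize D s = d at hDs hD' ⊢
    field_simp
    subst hDs
    linear_combination (4 * s * (p.eval s + 2 * s * p.derivative.eval s) * (2 * M * s - δ)) * hode
  have hFbounds {s : ℝ} (hs : s₁ ≤ s) (hs' : s ≤ 1 / 2) :
      s * p.eval s ^ 2 ≤ F s ∧ s * W s ^ 2 / D s ≤ 2 * F s := by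
    have hs₀ : 0 < s := hs₁₀.trans_le hs
    have hd := hDpos hs
    have h₁ : 0 ≤ s * W s ^ 2 / D s := by positivity
    have h₂ : F s = s * p.eval s ^ 2 + (1 - s) * (s * W s ^ 2 / D s) := by
      simp only [hF]; ring
    have h₃ : 0 ≤ s * p.eval s ^ 2 := by positivity
    constructor <;> nlinarith
  have hanti : AntitoneOn (fun s => exp (-(K * s)) * F s) (Icc s₁ (1 / 2)) := by
    have hd {s : ℝ} (hs : s₁ ≤ s) :=
      (((hasDerivAt_id s).const_mul K).neg.exp).mul (hderivF hs)
    refine antitoneOn_of_deriv_nonpos (convex_Icc _ _)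
      (fun s hs => (hd hs.1).continuousAt.continuousWithinAt)
      (fun s hs => (hd (interior_subset hs).1).differentiableAt.differentiableWithinAt)
      (fun s hs => ?_)
    have hs := interior_subset hs
    refine (hd hs.1).deriv.trans_le ?_
    have hD₀ := hDpos hs.1
    have hs₀ : 0 < s := hs₁₀.trans_le hs.1
    have h₁ : 0 ≤ (1 - s) * W s ^ 2 * (2 * D s * δ + δ / 2) / D s ^ 2 := by
      have : 0 ≤ 1 - s := by linarith [hs.2]
      positivity
    have h₂ : (2 * b + 1) * (s * W s ^ 2 / D s) ≤ |2 * b + 1| * (2 * F s) := by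
      have : 0 ≤ s * W s ^ 2 / D s := by positivity
      gcongr
      · exact le_abs_self _
      · exact (hFbounds hs.1 hs.2).2
    have h₃ : -(K * F s) + (-(1 - s) * W s ^ 2 * (2 * D s * δ + δ / 2) / D s ^ 2 +
        (2 * b + 1) * s * W s ^ 2 / D s) ≤ 0 := by
      rw [hK]
      linear_combination h₁ + h₂
    have := mul_nonpos_of_nonneg_of_nonpos (exp_pos (-(K * s))).le h₃
    simp only [id, Pi.neg_apply]
    linear_combination this
  have hle : exp (-(K * t)) * F t ≤ exp (-(K * s₁)) * F s₁ :=
    hanti ⟨le_rfl, hst.trans ht⟩ ⟨hst, ht⟩ hst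
  have hFt : 0 ≤ F s₁ := by
    have := (hFbounds le_rfl (hst.trans ht)).1
    have h : 0 ≤ s₁ * p.eval s₁ ^ 2 := by positivity
    exact h.trans this
  have hgrow : F t ≤ exp |2 * b + 1| * F s₁ := by
    calc F t = exp (K * t) * (exp (-(K * t)) * F t) := by
          rw [← mul_assoc, ← exp_add]; simp
      _ ≤ exp (K * t) * (exp (-(K * s₁)) * F s₁) := by gcongr
      _ = exp (K * (t - s₁)) * F s₁ := by
          rw [← mul_assoc, ← exp_add]; ring_nf
      _ ≤ exp |2 * b + 1| * F s₁ := by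
          gcongr
          rw [hK]
          nlinarith [abs_nonneg (2 * b + 1)]
  refine (hFbounds hst ht).1.trans (hgrow.trans ?_)
  gcongr
  have hDs₁ : D s₁ = δ / 2 := by
    simp only [hD, hs₁]
    field_simp
    ring
  have hs₁M : s₁ * (1 - s₁) * W s₁ ^ 2 / D s₁ = 2 / M * ((1 - s₁) * W s₁ ^ 2) := by
    rw [hDs₁]
    nth_rewrite 1 [hs₁]
    field_simp
  simp only [hF, hs₁M]
  gcongr
  change (1 - s₁) * W s₁ ^ 2 ≤ W s₁ ^ 2
  nlinarith [sq_nonneg (W s₁)]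

theorem jacobiP_sin_half_bound_first (a b : ℝ) (ha : 1 / 2 < a) (hb : -1 < b) :
    ∃ C : ℝ, 0 < C ∧ ∃ n₀ : ℕ, ∀ n : ℕ, n₀ ≤ n →
      ∀ θ ∈ Set.Icc (0 : ℝ) (π / 2),
        Real.sin (θ / 2) * |jacobiP a b n (Real.cos θ)| ≤ C * (n : ℝ) ^ (a - 1) := by
  obtain ⟨C, hC, n₀, hn₀⟩ := exists_jacobiCoeff_zero_le a b (by linarith)
  have hδ : 0 < a - 1 / 2 := by linarith
  set δ := a - 1 / 2 with hδ_def
  set L := exp |2 * b + 1| * ((δ + 8) * exp (2 * δ) ^ 2) with hL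
  have hL₀ : 0 < L := by positivity
  refine ⟨√L * C, by positivity, max n₀ 1, fun n hn θ hθ => ?_⟩
  have hn₁ : (1 : ℝ) ≤ n := by exact_mod_cast (le_max_right _ _).trans hn
  have hn_pos : (0 : ℝ) < n := by linarith
  have hA := hn₀ n ((le_max_left _ _).trans hn)
  have hA₀ := jacobiCoeff_nonneg (by linarith : 0 ≤ a + 1) (by linarith : 0 ≤ a + b + 1) n 0
  set A := jacobiCoeff a b n 0
  obtain ⟨M, hM⟩ : ∃ M, M = n * (n + a + b + 1) + (b + 1) / 2 + (a - 1 / 2) / 2 := ⟨_, rfl⟩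
  have hMle : n * (n + a + b + 1) ≤ M := by linarith
  have hnM : (n : ℝ) ^ 2 ≤ M := by nlinarith
  have hM₀ : 0 < M := by nlinarith
  have bounds {s : ℝ} (hs : 0 ≤ s) (hMs : M * s ≤ δ) :=
    jacobiPoly_bounds (by linarith) (by linarith) n hMle hs hMs
  set p := jacobiPoly a b n with hp
  have hsin : 0 ≤ sin (θ / 2) :=
    sin_nonneg_of_nonneg_of_le_pi (by linarith [hθ.1]) (by linarith [hθ.2, pi_pos])
  set s := sin (θ / 2) ^ 2 with hs
  have hcos : cos θ = 1 - 2 * s := by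
    rw [hs, sin_sq, show θ = 2 * (θ / 2) by ring, cos_two_mul]
    ring_nf
  have hs_half : s ≤ 1 / 2 := by
    have := cos_nonneg_of_neg_pi_div_two_le_of_le (by linarith [hθ.1, pi_pos]) hθ.2
    linarith
  have hs₀ : 0 ≤ s := sq_nonneg _
  have sq_bound {x : ℝ} {B : ℝ} (h : |x| ≤ B) : x ^ 2 ≤ B ^ 2 := by
    simpa using pow_le_pow_left₀ (abs_nonneg x) h 2
  have main : s * p.eval s ^ 2 ≤ L * A ^ 2 / M := by
    rcases le_total s (δ / M) with h | h
    · have hMs : M * s ≤ δ := by rwa [mul_comm, ← le_div_iff₀ hM₀]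
      calc s * p.eval s ^ 2 ≤ δ / M * (A * exp (2 * δ)) ^ 2 := by
            have := sq_bound (bounds hs₀ hMs).1
            gcongr
        _ = 1 * (δ * exp (2 * δ) ^ 2) * A ^ 2 / M := by ring
        _ ≤ L * A ^ 2 / M := by
            rw [hL]
            gcongr
            · exact one_le_exp (abs_nonneg _)
            · linarith
    · obtain ⟨h₁, h₂⟩ := bounds (s := δ / M) (by positivity) (mul_div_cancel₀ _ hM₀.ne').le
      have hW : |p.eval (δ / M) / 2 + δ / M * p.derivative.eval (δ / M)| ≤
          2 * (A * exp (2 * δ)) := by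
        rw [abs_le] at h₁ h₂ ⊢
        constructor <;> linarith
      calc s * p.eval s ^ 2 ≤ _ := jacobiPoly_energy_bound ha n hM hM₀ h hs_half
        _ ≤ exp |2 * b + 1| * (δ / M * (A * exp (2 * δ)) ^ 2 +
            2 / M * (2 * (A * exp (2 * δ))) ^ 2) := by
          have h₃ := sq_bound h₁
          have h₄ := sq_bound hW
          gcongr
        _ = L * A ^ 2 / M := by rw [hL]; ring
  rw [hcos, jacobiP_one_sub_two_mul, ← hp]
  refine abs_le_of_sq_le_sq' ?_ (by positivity) |>.2
  calc (sin (θ / 2) * |p.eval s|) ^ 2 = s * p.eval s ^ 2 := by rw [mul_pow, sq_abs]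
    _ ≤ L * A ^ 2 / M := main
    _ ≤ L * (C * (n : ℝ) ^ a) ^ 2 / (n : ℝ) ^ 2 := by gcongr
    _ = (√L * C * (n : ℝ) ^ (a - 1)) ^ 2 := by
      rw [rpow_sub_one hn_pos.ne', mul_pow, mul_pow, mul_pow, sq_sqrt hL₀.le]
      ring
end

section
/- For λ > -1/2, μ > 0, and all nonnegative integers n, the generalized Gegenbauer polynomial satisfies the integral representation C_n^{(λ,μ)}(t) = c_μ ∫_{-1}^{1} C_n^{λ+μ}(t x)(1+x)(1-x²)^{μ-1} dx for all t ∈ [-1,1], where c_μ^{-1} = 2 ∫_0^1 (1-x²)^{μ-1} dx. -/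
open Real Set

/-- Gegenbauer polynomial `C_n^l`. -/
noncomputable def gegenbauerC (l : ℝ) (n : ℕ) (t : ℝ) : ℝ :=
  (poch (2 * l) n / poch (l + 1 / 2) n) * jacobiP (l - 1 / 2) (l - 1 / 2) n t

/-- Generalized Gegenbauer polynomial `C_n^{(l,m)}`. -/
noncomputable def genGegenbauerC (l m : ℝ) (n : ℕ) (t : ℝ) : ℝ :=
  if Even n then
    (poch (l + m) (n / 2) / poch (m + 1 / 2) (n / 2)) *
      jacobiP (l - 1 / 2) (m - 1 / 2) (n / 2) (2 * t ^ 2 - 1)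
  else
    (poch (l + m) (n / 2 + 1) / poch (m + 1 / 2) (n / 2 + 1)) * t *
      jacobiP (l - 1 / 2) (m + 1 / 2) (n / 2) (2 * t ^ 2 - 1)

open Polynomial

section Pochhammer

lemma poch_zero (q : ℝ) : poch q 0 = 1 := by simp [poch]

lemma poch_succ (q : ℝ) (n : ℕ) : poch q (n + 1) = poch q n * (q + n) := by
  simp [poch, ascPochhammer_succ_eval]

lemma poch_add (q : ℝ) (n k : ℕ) : poch q (n + k) = poch q n * poch (q + n) k := by
  induction k with
  | zero => simp [poch_zero]
  | succ k ih => rw [← add_assoc, poch_succ, ih, poch_succ]; push_cast; ring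

lemma poch_succ_left (q : ℝ) (n : ℕ) : poch q (n + 1) = q * poch (q + 1) n := by
  rw [add_comm n 1, poch_add, poch_succ, poch_zero]; simp

lemma poch_pos {q : ℝ} (hq : 0 < q) (n : ℕ) : 0 < poch q n := ascPochhammer_pos n q hq

/-- The duplication formula for Pochhammer symbols. -/
lemma poch_two_mul (q : ℝ) (n : ℕ) :
    poch (2 * q) (2 * n) = 4 ^ n * poch q n * poch (q + 1 / 2) n := by
  induction n with
  | zero => simp [poch_zero]
  | succ n ih =>
    rw [show 2 * (n + 1) = 2 * n + 1 + 1 by ring, poch_succ, poch_succ, ih, poch_succ, poch_succ]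
    push_cast; ring

lemma poch_one (n : ℕ) : poch 1 n = n.factorial := by
  induction n with
  | zero => simp [poch_zero]
  | succ n ih => rw [poch_succ, ih, Nat.factorial_succ]; push_cast; ring

lemma factorial_two_mul_eq_poch (n : ℕ) :
    ((2 * n).factorial : ℝ) = 4 ^ n * poch (1 / 2) n * n.factorial := by
  have h := poch_two_mul (1 / 2) n
  norm_num [poch_one] at h
  rw [h]

lemma factorial_two_mul_add_one_eq_poch (n : ℕ) :
    ((2 * n + 1).factorial : ℝ) = 4 ^ n * poch (3 / 2) n * n.factorial := by
  have h := poch_two_mul 1 n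
  have h2 := poch_succ_left 1 (2 * n)
  rw [poch_one] at h2
  rw [h2, show (1 : ℝ) + 1 = 2 * 1 by norm_num, h, poch_one]
  norm_num; ring

end Pochhammer

section HypergeometricEquation

lemma coeff_X_mul_derivative (p : ℝ[X]) (k : ℕ) :
    (X * derivative p).coeff k = k * p.coeff k := by
  cases k with
  | zero => simp
  | succ k => rw [coeff_X_mul, coeff_derivative]; push_cast; ring

lemma coeff_X_mul_derivative_derivative (p : ℝ[X]) (k : ℕ) :
    (X * derivative (derivative p)).coeff k = (k + 1) * k * p.coeff (k + 1) := by
  rw [coeff_X_mul_derivative, coeff_derivative]; ring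

lemma coeff_X_sq_mul_derivative_derivative (p : ℝ[X]) (k : ℕ) :
    (X ^ 2 * derivative (derivative p)).coeff k = k * (k - 1) * p.coeff k := by
  cases k with
  | zero => simp [pow_two, mul_assoc]
  | succ k =>
    rw [pow_two, mul_assoc, coeff_X_mul, coeff_X_mul_derivative_derivative]; push_cast; ring

/-- A polynomial solution of degree less than `n` of the hypergeometric-type differential equation
with eigenvalue parameter `n` vanishes. -/
lemma eq_zero_of_hypergeometric_equation {n : ℕ} {r₀ r₁ s d : ℝ} (hd : 0 < d) {p : ℝ[X]}
    (hdeg : p.natDegree ≤ n) (hn : p.coeff n = 0)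
    (h : (C r₀ + C r₁ * X - X ^ 2) * derivative (derivative p) + (C s - C d * X) * derivative p +
      C (n * (n + d - 1)) * p = 0) : p = 0 := by
  by_contra hp
  have hlead : p.coeff p.natDegree ≠ 0 := by simpa using hp
  have hlt : p.natDegree < n := by
    refine lt_of_le_of_ne hdeg fun he => hlead ?_
    rwa [he]
  set k := p.natDegree
  have e1 : p.coeff (k + 1) = 0 := coeff_eq_zero_of_natDegree_lt (by omega)
  have e2 : p.coeff (k + 2) = 0 := coeff_eq_zero_of_natDegree_lt (by omega)
  have hk := congrArg (fun q => coeff q k) h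
  simp only [add_mul, sub_mul, mul_assoc, coeff_add, coeff_sub, coeff_C_mul, coeff_X_mul_derivative,
    coeff_X_sq_mul_derivative_derivative, coeff_derivative,
    coeff_zero, e1, e2] at hk
  have hk' : ((n : ℝ) - k) * (n + k - 1 + d) * p.coeff k = 0 := by linear_combination hk
  have hlt' : (k : ℝ) + 1 ≤ n := by exact_mod_cast hlt
  have hk0 : (0 : ℝ) ≤ k := k.cast_nonneg
  have h1 : (n : ℝ) - k ≠ 0 := by linarith
  have h2 : (n : ℝ) + k - 1 + d ≠ 0 := by linarith
  exact hlead (by simpa [h1, h2] using hk')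

/-- The coefficients of the polynomial `₂F₁(-n, n + d - 1; c; X)`. -/
noncomputable def hypCoeff (n : ℕ) (d c : ℝ) (k : ℕ) : ℝ :=
  (-1) ^ k * n.choose k * poch (n + d - 1) k / poch c k

/-- The polynomial `₂F₁(-n, n + d - 1; c; X)`. -/
noncomputable def hypPoly (n : ℕ) (d c : ℝ) : ℝ[X] :=
  ∑ k ∈ Finset.range (n + 1), C (hypCoeff n d c k) * X ^ k

lemma hypCoeff_of_lt {n k : ℕ} (h : n < k) (d c : ℝ) : hypCoeff n d c k = 0 := by
  simp [hypCoeff, Nat.choose_eq_zero_of_lt h]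

lemma coeff_hypPoly (n : ℕ) (d c : ℝ) (k : ℕ) : (hypPoly n d c).coeff k = hypCoeff n d c k := by
  rw [hypPoly, finsetSum_coeff]
  simp only [coeff_C_mul_X_pow, Finset.sum_ite_eq, Finset.mem_range]
  split_ifs with h
  · rfl
  · rw [hypCoeff_of_lt (by omega)]

lemma eval_hypPoly (n : ℕ) (d c x : ℝ) :
    (hypPoly n d c).eval x = ∑ k ∈ Finset.range (n + 1), hypCoeff n d c k * x ^ k := by
  simp [hypPoly, eval_finsetSum]

lemma natDegree_hypPoly_le (n : ℕ) (d c : ℝ) : (hypPoly n d c).natDegree ≤ n :=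
  natDegree_le_iff_coeff_eq_zero.2 fun k hk => by rw [coeff_hypPoly, hypCoeff_of_lt hk]

lemma hypCoeff_succ (n : ℕ) (d : ℝ) {c : ℝ} (hc : 0 < c) (k : ℕ) :
    (k + 1) * (k + c) * hypCoeff n d c (k + 1) = -((n - k) * (n + k + d - 1)) * hypCoeff n d c k := by
  have hch : (n.choose (k + 1) : ℝ) * (k + 1) = n.choose k * (n - k) := by
    rcases le_or_gt k n with h | h
    · have := Nat.choose_succ_right_eq n k
      rw [← Nat.cast_sub h]; exact_mod_cast this
    · simp [Nat.choose_eq_zero_of_lt h, Nat.choose_eq_zero_of_lt (h.trans k.lt_succ_self)]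
  have h1 := (poch_pos hc k).ne'
  have h2 : c + k ≠ 0 := by positivity
  simp only [hypCoeff, poch_succ]
  field_simp
  rw [pow_succ]
  linear_combination (-(-1) ^ k * poch (n + d - 1) k * (n + d - 1 + k) * (c + k)) * hch

lemma hypPoly_equation (n : ℕ) (d : ℝ) {c : ℝ} (hc : 0 < c) :
    (X - X ^ 2) * derivative (derivative (hypPoly n d c)) +
      (C c - C d * X) * derivative (hypPoly n d c) + C (n * (n + d - 1)) * hypPoly n d c = 0 := by
  ext k
  simp only [sub_mul, mul_assoc, coeff_add, coeff_sub, coeff_C_mul, coeff_X_mul_derivative,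
    coeff_X_sq_mul_derivative_derivative, coeff_derivative,
    coeff_zero, coeff_hypPoly]
  linear_combination hypCoeff_succ n d hc k

lemma coeff_comp_of_natDegree_le {p q : ℝ[X]} {n m : ℕ} (hp : p.natDegree ≤ n)
    (hq : q.natDegree ≤ m) (hm : 0 < m) :
    (p.comp q).coeff (n * m) = p.coeff n * q.coeff m ^ n := by
  rw [comp, eval₂_eq_sum_range' C (Nat.lt_succ_of_le hp), finsetSum_coeff, Finset.sum_range_succ,
    coeff_C_mul, mul_comm n m, mul_comm m n, coeff_pow_of_natDegree_le hq, add_eq_right]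
  refine Finset.sum_eq_zero fun i hi => ?_
  rw [coeff_C_mul, coeff_eq_zero_of_natDegree_lt (p := q ^ i), mul_zero]
  exact (natDegree_pow_le_of_le i hq).trans_lt
    (Nat.mul_lt_mul_of_pos_right (Finset.mem_range.1 hi) hm)

/-- The reflection formula `x ↦ 1 - x`. -/
lemma hypPoly_comp_one_sub (n : ℕ) {c c' : ℝ} (hc : 0 < c) (hc' : 0 < c') :
    C (poch c n) * (hypPoly n (c + c') c).comp (1 - X) =
      C ((-1) ^ n * poch c' n) * hypPoly n (c + c') c' := by
  have hq : (1 - X : ℝ[X]).natDegree ≤ 1 := by compute_degree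
  rw [← sub_eq_zero]
  refine eq_zero_of_hypergeometric_equation (n := n) (r₀ := 0) (r₁ := 1) (s := c') (d := c + c')
    (by positivity) ?_ ?_ ?_
  · refine (natDegree_sub_le_of_le (natDegree_C_mul_le _ _ |>.trans ?_)
      (natDegree_C_mul_le _ _ |>.trans (natDegree_hypPoly_le _ _ _))).trans (max_self n).le
    refine natDegree_comp_le.trans ?_
    calc _ ≤ n * 1 := Nat.mul_le_mul (natDegree_hypPoly_le _ _ _) hq
      _ = n := mul_one n
  · have := coeff_comp_of_natDegree_le (natDegree_hypPoly_le n (c + c') c) hq one_pos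
    rw [mul_one] at this
    rw [coeff_sub, coeff_C_mul, coeff_C_mul, this, coeff_hypPoly, coeff_hypPoly]
    have h1 := (poch_pos hc n).ne'
    have h2 := (poch_pos hc' n).ne'
    simp [hypCoeff, coeff_one]
    field_simp
    ring
  · have h1 := congrArg (fun p => p.comp (1 - X)) (hypPoly_equation n (c + c') hc)
    have h2 := hypPoly_equation n (c + c') hc'
    simp only [add_comp, sub_comp, mul_comp, C_comp, X_comp, zero_comp, pow_comp] at h1
    simp only [derivative_mul, derivative_C, derivative_comp, derivative_one,
      derivative_X, map_add, map_zero, map_one, map_mul, map_sub] at h1 h2 ⊢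
    linear_combination C (poch c n) * h1 - C ((-1) ^ n) * C (poch c' n) * h2

end HypergeometricEquation

section Gegenbauer

lemma jacobiP_eq_eval_hypPoly {a : ℝ} (ha : -1 < a) (b : ℝ) (n : ℕ) (x : ℝ) :
    jacobiP a b n x =
      poch (a + 1) n / n.factorial * (hypPoly n (a + b + 2) (a + 1)).eval ((1 - x) / 2) := by
  rw [eval_hypPoly, jacobiP, div_eq_inv_mul (poch _ _), mul_assoc,
    Finset.mul_sum (Finset.range (n + 1)) _ (poch _ _)]
  congr 1
  refine Finset.sum_congr rfl fun k hk => ?_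
  have hk : k ≤ n := by simpa [Nat.lt_succ_iff] using hk
  have h := poch_add (a + 1) k (n - k)
  rw [Nat.add_sub_cancel' hk] at h
  have h1 := (poch_pos (by linarith : 0 < a + 1) k).ne'
  rw [h, hypCoeff, show (x - 1) / 2 = -1 * ((1 - x) / 2) by ring, mul_pow,
    show (n : ℝ) + (a + b + 2) - 1 = n + a + b + 1 by ring, show a + 1 + k = a + k + 1 by ring]
  simp only [poch] at h1 ⊢
  field_simp

lemma jacobiP_two_mul_sub_one {a b : ℝ} (ha : -1 < a) (hb : -1 < b) (n : ℕ) (s : ℝ) :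
    jacobiP a b n (2 * s - 1) =
      (-1) ^ n * poch (b + 1) n / n.factorial * (hypPoly n (a + b + 2) (b + 1)).eval s := by
  have h := congrArg (eval s) (hypPoly_comp_one_sub n (by linarith : 0 < a + 1)
    (by linarith : 0 < b + 1))
  simp only [eval_mul, eval_C, eval_comp, eval_sub, eval_one, eval_X] at h
  rw [show a + 1 + (b + 1) = a + b + 2 by ring] at h
  rw [jacobiP_eq_eval_hypPoly ha, show (1 - (2 * s - 1)) / 2 = 1 - s by ring, div_mul_eq_mul_div, h]
  ring

lemma genGegenbauerC_two_mul {l m : ℝ} (hl : -(1 / 2 : ℝ) < l) (hm : 0 < m) (n : ℕ) (t : ℝ) :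
    genGegenbauerC l m (2 * n) t =
      (-1) ^ n * poch (l + m) n / n.factorial *
        (hypPoly n (l + m + 1) (m + 1 / 2)).eval (t ^ 2) := by
  have h := (poch_pos (by linarith : 0 < m + 1 / 2) n).ne'
  rw [genGegenbauerC, if_pos (even_two_mul n), Nat.mul_div_cancel_left n two_pos,
    jacobiP_two_mul_sub_one (by linarith) (by linarith),
    show m - 1 / 2 + 1 = m + 1 / 2 by ring, show l - 1 / 2 + (m - 1 / 2) + 2 = l + m + 1 by ring]
  generalize poch (m + 1 / 2) n = q, hypPoly n (l + m + 1) (m + 1 / 2) = p at h ⊢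
  field_simp

lemma genGegenbauerC_two_mul_add_one {l m : ℝ} (hl : -(1 / 2 : ℝ) < l) (hm : 0 < m) (n : ℕ)
    (t : ℝ) :
    genGegenbauerC l m (2 * n + 1) t =
      (-1) ^ n * poch (l + m) (n + 1) / (n.factorial * (m + 1 / 2)) * t *
        (hypPoly n (l + m + 2) (m + 3 / 2)).eval (t ^ 2) := by
  have h := (poch_pos (by linarith : 0 < m + 3 / 2) n).ne'
  have h' : m + 1 / 2 ≠ 0 := by positivity
  rw [genGegenbauerC, if_neg (by simp), show (2 * n + 1) / 2 = n by omega,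
    jacobiP_two_mul_sub_one (by linarith) (by linarith), poch_succ_left (m + 1 / 2),
    show m + 1 / 2 + 1 = m + 3 / 2 by ring, show l - 1 / 2 + (m + 1 / 2) + 2 = l + m + 2 by ring]
  generalize poch (m + 3 / 2) n = q, hypPoly n (l + m + 2) (m + 3 / 2) = p at h ⊢
  field_simp

lemma gegenbauerC_eq_eval_hypPoly {v : ℝ} (hv : -(1 / 2 : ℝ) < v) (n : ℕ) (t : ℝ) :
    gegenbauerC v n t =
      poch (2 * v) n / n.factorial * (hypPoly n (2 * v + 1) (v + 1 / 2)).eval ((1 - t) / 2) := by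
  have h := (poch_pos (by linarith : 0 < v + 1 / 2) n).ne'
  rw [gegenbauerC, jacobiP_eq_eval_hypPoly (by linarith),
    show v - 1 / 2 + 1 = v + 1 / 2 by ring, show v - 1 / 2 + (v - 1 / 2) + 2 = 2 * v + 1 by ring]
  generalize poch (v + 1 / 2) n = q, hypPoly n (2 * v + 1) (v + 1 / 2) = p at h ⊢
  field_simp

/-- The Gegenbauer polynomial `C_n^v` as an element of `ℝ[X]`. -/
noncomputable def gegenbauerPoly (v : ℝ) (n : ℕ) : ℝ[X] :=
  C (poch (2 * v) n / n.factorial) *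
    (hypPoly n (2 * v + 1) (v + 1 / 2)).comp (C (1 / 2) * (1 - X))

lemma natDegree_half_mul_one_sub_X : (C (1 / 2) * (1 - X) : ℝ[X]).natDegree ≤ 1 := by
  compute_degree

lemma eval_gegenbauerPoly {v : ℝ} (hv : -(1 / 2 : ℝ) < v) (n : ℕ) (t : ℝ) :
    (gegenbauerPoly v n).eval t = gegenbauerC v n t := by
  rw [gegenbauerC_eq_eval_hypPoly hv, gegenbauerPoly]
  simp only [eval_mul, eval_C, eval_comp, eval_sub, eval_one, eval_X]
  ring_nf

lemma natDegree_gegenbauerPoly_le (v : ℝ) (n : ℕ) : (gegenbauerPoly v n).natDegree ≤ n := by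
  refine (natDegree_C_mul_le _ _).trans (natDegree_comp_le.trans ?_)
  calc _ ≤ n * 1 := Nat.mul_le_mul (natDegree_hypPoly_le _ _ _) natDegree_half_mul_one_sub_X
    _ = n := mul_one n

lemma coeff_gegenbauerPoly {v : ℝ} (hv : -(1 / 2 : ℝ) < v) (n : ℕ) :
    (gegenbauerPoly v n).coeff n = 2 ^ n * poch v n / n.factorial := by
  have h := coeff_comp_of_natDegree_le (natDegree_hypPoly_le n (2 * v + 1) (v + 1 / 2))
    natDegree_half_mul_one_sub_X one_pos
  rw [mul_one] at h
  have h0 := (poch_pos (by linarith : 0 < v + 1 / 2) n).ne'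
  have hd := poch_two_mul v n
  rw [two_mul n, poch_add] at hd
  have hc : (C (1 / 2) * (1 - X) : ℝ[X]).coeff 1 = -(1 / 2) := by
    rw [coeff_C_mul, coeff_sub, coeff_one, coeff_X_one]; norm_num
  rw [gegenbauerPoly, coeff_C_mul, h, coeff_hypPoly, hypCoeff, hc,
    show (n : ℝ) + (2 * v + 1) - 1 = 2 * v + n by ring, Nat.choose_self, neg_pow (1 / 2 : ℝ)]
  have h4 : (4 : ℝ) ^ n = 2 ^ n * 2 ^ n := by rw [← mul_pow]; norm_num
  have hs : ((-1 : ℝ) ^ n) * (-1) ^ n = 1 := by rw [← mul_pow]; norm_num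
  have h2 : (1 / 2 : ℝ) ^ n * 2 ^ n = 1 := by rw [← mul_pow]; norm_num
  rw [h4] at hd
  generalize poch (v + 1 / 2) n = q at h0 hd ⊢
  generalize (1 / 2 : ℝ) ^ n = r at h2 ⊢
  field_simp
  push_cast
  linear_combination (poch (2 * v) n * poch (2 * v + n) n * r) * hs +
    r * hd + 2 ^ n * poch v n * q * h2

lemma gegenbauerPoly_equation {v : ℝ} (hv : -(1 / 2 : ℝ) < v) (n : ℕ) :
    (1 - X ^ 2) * derivative (derivative (gegenbauerPoly v n)) -
      C (2 * v + 1) * X * derivative (gegenbauerPoly v n) +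
      C (n * (n + 2 * v)) * gegenbauerPoly v n = 0 := by
  have h := congrArg (fun p => p.comp (C (1 / 2) * (1 - X)))
    (hypPoly_equation n (2 * v + 1) (by linarith : 0 < v + 1 / 2))
  simp only [add_comp, sub_comp, mul_comp, C_comp, X_comp, zero_comp, pow_comp] at h
  have hh : (C (1 / 2) : ℝ[X]) * 2 = 1 := by
    rw [← C_ofNat, ← C_mul]; norm_num
  rw [gegenbauerPoly]
  simp only [derivative_mul, derivative_C, derivative_comp, derivative_one,
    derivative_X, map_add, map_zero, map_one, map_mul, map_sub, map_ofNat, map_natCast] at h hh ⊢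
  set A := C (poch (2 * v) n / (n.factorial : ℝ))
  set p := hypPoly n (2 * v + 1) (v + 1 / 2)
  set q : ℝ[X] := C (1 / 2) * (1 - X)
  linear_combination A * h + (1 - X) * C (1 / 2) * A * (derivative (derivative p)).comp q * hh +
    C v * A * (derivative p).comp q * hh

lemma gegenbauerPoly_unique {v : ℝ} (hv : -(1 / 2 : ℝ) < v) (n : ℕ) {p : ℝ[X]}
    (hdeg : p.natDegree ≤ n) (hlead : p.coeff n = 2 ^ n * poch v n / n.factorial)
    (h : (1 - X ^ 2) * derivative (derivative p) - C (2 * v + 1) * X * derivative p +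
      C (n * (n + 2 * v)) * p = 0) : gegenbauerPoly v n = p := by
  rw [← sub_eq_zero]
  refine eq_zero_of_hypergeometric_equation (n := n) (r₀ := 1) (r₁ := 0) (s := 0) (d := 2 * v + 1)
    (by linarith) ((natDegree_sub_le_of_le (natDegree_gegenbauerPoly_le v n) hdeg).trans (max_self n).le) ?_ ?_
  · rw [coeff_sub, coeff_gegenbauerPoly hv, hlead, sub_self]
  · rw [show (n : ℝ) + (2 * v + 1) - 1 = n + 2 * v by ring]
    simp only [derivative_sub, map_zero, map_one]
    linear_combination gegenbauerPoly_equation hv n - h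

lemma natDegree_hypPoly_comp_X_sq_le (n : ℕ) (d c : ℝ) :
    ((hypPoly n d c).comp (X ^ 2)).natDegree ≤ 2 * n := by
  refine natDegree_comp_le.trans ?_
  rw [natDegree_X_pow, mul_comm]
  exact Nat.mul_le_mul_left 2 (natDegree_hypPoly_le n d c)

lemma coeff_hypPoly_comp_X_sq (n : ℕ) (d c : ℝ) :
    ((hypPoly n d c).comp (X ^ 2)).coeff (2 * n) =
      (-1) ^ n * poch (n + d - 1) n / poch c n := by
  rw [mul_comm, coeff_comp_of_natDegree_le (natDegree_hypPoly_le n d c) (natDegree_X_pow 2).le two_pos,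
    coeff_hypPoly, coeff_X_pow]
  simp [hypCoeff]

lemma gegenbauerPoly_two_mul {v : ℝ} (hv : -(1 / 2 : ℝ) < v) (n : ℕ) :
    gegenbauerPoly v (2 * n) =
      C ((-1) ^ n * poch v n / n.factorial) * (hypPoly n (v + 1) (1 / 2)).comp (X ^ 2) := by
  refine gegenbauerPoly_unique hv _
    ((natDegree_C_mul_le _ _).trans (natDegree_hypPoly_comp_X_sq_le _ _ _)) ?_ ?_
  · have h0 := (poch_pos (by norm_num : (0 : ℝ) < 1 / 2) n).ne'
    have hs : ((-1 : ℝ) ^ n) * (-1) ^ n = 1 := by rw [← mul_pow]; norm_num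
    rw [coeff_C_mul, coeff_hypPoly_comp_X_sq, factorial_two_mul_eq_poch, two_mul n, poch_add,
      show (n : ℝ) + (v + 1) - 1 = v + n by ring, pow_add, ← mul_pow]
    norm_num
    field_simp
    linear_combination (poch v n * poch (v + n) n) * hs
  · have h := congrArg (fun p => p.comp (X ^ 2)) (hypPoly_equation n (v + 1) one_half_pos)
    simp only [add_comp, sub_comp, mul_comp, C_comp, X_comp, zero_comp, pow_comp] at h
    have hh : (C (1 / 2) : ℝ[X]) * 2 = 1 := by
      rw [← C_ofNat, ← C_mul]; norm_num
    simp only [derivative_mul, derivative_C, derivative_comp, derivative_X_pow, derivative_natCast,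
      map_add, map_sub, map_zero, map_one, map_mul, map_ofNat, map_natCast] at h hh ⊢
    push_cast
    linear_combination C ((-1) ^ n * poch v n / n.factorial) * (4 * h -
      2 * (derivative (hypPoly n (v + 1) (1 / 2))).comp (X ^ 2) * hh)

lemma gegenbauerPoly_two_mul_add_one {v : ℝ} (hv : -(1 / 2 : ℝ) < v) (n : ℕ) :
    gegenbauerPoly v (2 * n + 1) =
      C (2 * (-1) ^ n * poch v (n + 1) / n.factorial) *
        ((hypPoly n (v + 2) (3 / 2)).comp (X ^ 2) * X) := by
  refine gegenbauerPoly_unique hv _ ((natDegree_C_mul_le _ _).trans (natDegree_mul_le_of_le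
    (natDegree_hypPoly_comp_X_sq_le _ _ _) natDegree_X_le)) ?_ ?_
  · have h0 := (poch_pos (by norm_num : (0 : ℝ) < 3 / 2) n).ne'
    have hs : ((-1 : ℝ) ^ n) * (-1) ^ n = 1 := by rw [← mul_pow]; norm_num
    rw [coeff_C_mul, coeff_mul_X, coeff_hypPoly_comp_X_sq, factorial_two_mul_add_one_eq_poch,
      show 2 * n + 1 = (n + 1) + n by ring, poch_add v (n + 1),
      show (n : ℝ) + (v + 2) - 1 = v + (n + 1 : ℕ) by push_cast; ring,
      show n + 1 + n = n + n + 1 by ring, pow_succ, pow_add, ← mul_pow]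
    norm_num
    field_simp
    linear_combination (poch v (n + 1) * poch (v + (n + 1)) n) * hs
  · have h := congrArg (fun p => p.comp (X ^ 2))
      (hypPoly_equation n (v + 2) (by norm_num : (0 : ℝ) < 3 / 2))
    simp only [add_comp, sub_comp, mul_comp, C_comp, X_comp, zero_comp, pow_comp] at h
    have hh : (C (3 / 2) : ℝ[X]) * 2 = 3 := by
      rw [← C_ofNat, ← C_mul, ← C_ofNat]; norm_num
    simp only [derivative_mul, derivative_C, derivative_comp, derivative_X_pow, derivative_natCast,
      derivative_one, derivative_X, map_add, map_sub, map_zero, map_one, map_mul, map_ofNat,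
      map_natCast] at h hh ⊢
    push_cast
    linear_combination C (2 * (-1) ^ n * poch v (n + 1) / n.factorial) * X * (4 * h -
      2 * (derivative (hypPoly n (v + 2) (3 / 2))).comp (X ^ 2) * hh)

end Gegenbauer

section Moments

lemma intervalIntegrable_one_sub_sq_rpow {m : ℝ} (hm : 0 < m) :
    IntervalIntegrable (fun x : ℝ => (1 - x ^ 2) ^ (m - 1)) MeasureTheory.volume (-1) 1 := by
  have h1 : IntervalIntegrable (fun x : ℝ => (1 - x ^ 2) ^ (m - 1)) MeasureTheory.volume 0 1 := by
    have h := (intervalIntegral.intervalIntegrable_rpow' (a := 0) (b := 1)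
      (by linarith : -1 < m - 1)).comp_sub_left 1
    simp only [sub_zero, sub_self] at h
    have hc : ContinuousOn (fun x : ℝ => (1 + x) ^ (m - 1)) (Set.uIcc 0 1) := by
      refine ContinuousOn.rpow_const (by fun_prop) fun x hx => Or.inl ?_
      rw [Set.uIcc_of_le zero_le_one] at hx
      linarith [hx.1]
    refine (h.symm.mul_continuousOn hc).congr fun x hx => ?_
    rw [Set.uIoc_of_le zero_le_one] at hx
    rw [← Real.mul_rpow (by linarith [hx.2]) (by linarith [hx.1])]
    ring_nf
  have h2 := (IntervalIntegrable.iff_comp_neg (by finiteness)).1 h1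
  simp only [neg_sq, neg_zero] at h2
  exact h2.symm.trans h1

lemma intervalIntegrable_pow_mul_one_sub_sq_rpow {m : ℝ} (hm : 0 < m) (k : ℕ) :
    IntervalIntegrable (fun x : ℝ => x ^ k * (1 - x ^ 2) ^ (m - 1)) MeasureTheory.volume (-1) 1 :=
  (intervalIntegrable_one_sub_sq_rpow hm).continuousOn_mul (by fun_prop)

/-- The moments of the weight `(1 - x²)^(m - 1)` on `[-1, 1]`. -/
noncomputable def weightMoment (m : ℝ) (k : ℕ) : ℝ :=
  ∫ x in (-1 : ℝ)..1, x ^ k * (1 - x ^ 2) ^ (m - 1)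

lemma weightMoment_zero {m : ℝ} (hm : 0 < m) :
    weightMoment m 0 = 2 * ∫ x in (0 : ℝ)..1, (1 - x ^ 2) ^ (m - 1) := by
  have h := intervalIntegrable_one_sub_sq_rpow hm
  have h1 := intervalIntegral.integral_comp_neg (a := 0) (b := 1)
    (fun x : ℝ => (1 - x ^ 2) ^ (m - 1))
  simp only [neg_sq, neg_zero] at h1
  have h0 : (0 : ℝ) ∈ Set.uIcc (-1) 1 := by norm_num [Set.uIcc_of_le]
  have h2 := intervalIntegral.integral_add_adjacent_intervals (b := 0)
    (h.mono_set (Set.uIcc_subset_uIcc Set.left_mem_uIcc h0))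
    (h.mono_set (Set.uIcc_subset_uIcc h0 Set.right_mem_uIcc))
  simp only [weightMoment, pow_zero, one_mul]
  rw [← h2, ← h1]; ring

lemma weightMoment_zero_pos {m : ℝ} (hm : 0 < m) : 0 < weightMoment m 0 := by
  simp only [weightMoment, pow_zero, one_mul]
  refine intervalIntegral.intervalIntegral_pos_of_pos_on (intervalIntegrable_one_sub_sq_rpow hm)
    (fun x hx => Real.rpow_pos_of_pos ?_ _) (by norm_num)
  nlinarith [hx.1, hx.2]

lemma weightMoment_odd (m : ℝ) (k : ℕ) : weightMoment m (2 * k + 1) = 0 := by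
  have h := intervalIntegral.integral_comp_neg (a := -1) (b := 1)
    (fun x : ℝ => x ^ (2 * k + 1) * (1 - x ^ 2) ^ (m - 1))
  simp only [neg_sq, (odd_two_mul_add_one k).neg_pow, neg_mul, neg_neg,
    intervalIntegral.integral_neg] at h
  rw [weightMoment]
  linarith

lemma weightMoment_add_two {m : ℝ} (hm : 0 < m) (k : ℕ) :
    (k + 1 + 2 * m) * weightMoment m (k + 2) = (k + 1) * weightMoment m k := by
  have i1 := (intervalIntegrable_pow_mul_one_sub_sq_rpow hm k).const_mul (k + 1 : ℝ)
  have i2 := (intervalIntegrable_pow_mul_one_sub_sq_rpow hm (k + 2)).const_mul (k + 1 + 2 * m)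
  have h := intervalIntegral.integral_eq_sub_of_hasDerivAt_of_le (a := -1) (b := 1)
    (by norm_num) (f := fun x : ℝ => x ^ (k + 1) * (1 - x ^ 2) ^ m) ?_ ?_ (i1.sub i2)
  · rw [intervalIntegral.integral_sub i1 i2, intervalIntegral.integral_const_mul,
      intervalIntegral.integral_const_mul] at h
    norm_num [Real.zero_rpow hm.ne'] at h
    simp only [weightMoment]
    linarith
  · refine ContinuousOn.mul (by fun_prop) (ContinuousOn.rpow_const (by fun_prop) ?_)
    exact fun x _ => Or.inr hm.le
  · intro x hx
    have hpos : 0 < 1 - x ^ 2 := by nlinarith [hx.1, hx.2]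
    have hd := (hasDerivAt_pow (k + 1) x).mul
      (((hasDerivAt_pow 2 x).const_sub 1).rpow_const (p := m) (Or.inl hpos.ne'))
    refine hd.congr_deriv ?_
    have hr : (1 - x ^ 2) ^ m = (1 - x ^ 2) ^ (m - 1) * (1 - x ^ 2) := by
      rw [← Real.rpow_add_one hpos.ne', sub_add_cancel]
    rw [hr]
    push_cast
    ring

lemma weightMoment_two_mul {m : ℝ} (hm : 0 < m) (k : ℕ) :
    weightMoment m (2 * k) = weightMoment m 0 * (poch (1 / 2) k / poch (m + 1 / 2) k) := by
  induction k with
  | zero => simp [poch_zero]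
  | succ k ih =>
    have h := weightMoment_add_two hm (2 * k)
    have h0 := (poch_pos (by linarith : 0 < m + 1 / 2) k).ne'
    have h1 : m + 1 / 2 + k ≠ 0 := by positivity
    rw [ih] at h
    rw [show 2 * (k + 1) = 2 * k + 2 by ring, poch_succ, poch_succ]
    push_cast at h
    field_simp at h ⊢
    linear_combination h

lemma integral_eval_mul_weight {m : ℝ} (hm : 0 < m) (n : ℕ) (c : ℕ → ℝ) (e : ℕ → ℕ) :
    ∫ x in (-1 : ℝ)..1, (∑ k ∈ Finset.range n, c k * x ^ e k) * (1 + x) * (1 - x ^ 2) ^ (m - 1) =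
      ∑ k ∈ Finset.range n, c k * (weightMoment m (e k) + weightMoment m (e k + 1)) := by
  have hi (k : ℕ) := intervalIntegrable_pow_mul_one_sub_sq_rpow hm k
  simp only [weightMoment]
  simp_rw [← intervalIntegral.integral_add (hi _) (hi _), ← intervalIntegral.integral_const_mul]
  rw [← intervalIntegral.integral_finsetSum
    fun k _ => ((hi (e k)).add (hi (e k + 1))).const_mul (c k)]
  congr 1
  ext x
  rw [Finset.sum_mul, Finset.sum_mul]
  exact Finset.sum_congr rfl fun k _ => by ring

end Moments

theorem genGegenbauer_integral_representation (l m : ℝ) (hl : -(1 / 2 : ℝ) < l) (hm : 0 < m)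
    (n : ℕ) (t : ℝ) (ht : t ∈ Set.Icc (-1 : ℝ) 1) :
    genGegenbauerC l m n t =
      (2 * ∫ x in (0 : ℝ)..1, (1 - x ^ 2) ^ (m - 1))⁻¹ *
        ∫ x in (-1 : ℝ)..1, gegenbauerC (l + m) n (t * x) * (1 + x) * (1 - x ^ 2) ^ (m - 1) := by
  have hv : -(1 / 2 : ℝ) < l + m := by linarith
  have hM := (weightMoment_zero_pos hm).ne'
  rw [← weightMoment_zero hm]
  obtain ⟨k, rfl | rfl⟩ := n.even_or_odd'
  · have hC (x : ℝ) : gegenbauerC (l + m) (2 * k) (t * x) =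
        ∑ j ∈ Finset.range (k + 1), (-1) ^ k * poch (l + m) k / k.factorial *
          hypCoeff k (l + m + 1) (1 / 2) j * t ^ (2 * j) * x ^ (2 * j) := by
      rw [← eval_gegenbauerPoly hv, gegenbauerPoly_two_mul hv, eval_mul, eval_C, eval_comp,
        eval_pow, eval_X, eval_hypPoly, Finset.mul_sum]
      exact Finset.sum_congr rfl fun j _ => by rw [mul_pow t x, mul_pow, pow_mul, pow_mul]; ring
    simp_rw [hC]
    rw [integral_eval_mul_weight hm, genGegenbauerC_two_mul hl hm, eval_hypPoly, Finset.mul_sum,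
      Finset.mul_sum]
    refine Finset.sum_congr rfl fun j _ => ?_
    have h1 := (poch_pos (one_half_pos (α := ℝ)) j).ne'
    have h2 := (poch_pos (by linarith : 0 < m + 1 / 2) j).ne'
    rw [weightMoment_odd, weightMoment_two_mul hm, hypCoeff, hypCoeff]
    field_simp
    ring
  · have hC (x : ℝ) : gegenbauerC (l + m) (2 * k + 1) (t * x) =
        ∑ j ∈ Finset.range (k + 1), 2 * (-1) ^ k * poch (l + m) (k + 1) / k.factorial *
          hypCoeff k (l + m + 2) (3 / 2) j * t ^ (2 * j + 1) * x ^ (2 * j + 1) := by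
      rw [← eval_gegenbauerPoly hv, gegenbauerPoly_two_mul_add_one hv, eval_mul, eval_C, eval_mul,
        eval_comp, eval_pow, eval_X, eval_hypPoly, Finset.sum_mul, Finset.mul_sum]
      exact Finset.sum_congr rfl fun j _ => by
        rw [mul_pow t x, mul_pow, pow_succ t (2 * j), pow_succ x (2 * j), pow_mul, pow_mul]; ring
    simp_rw [hC]
    rw [integral_eval_mul_weight hm, genGegenbauerC_two_mul_add_one hl hm, eval_hypPoly,
      Finset.mul_sum, Finset.mul_sum]
    refine Finset.sum_congr rfl fun j _ => ?_
    have h1 := (poch_pos (by norm_num : (0 : ℝ) < 3 / 2) j).ne'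
    have h2 := (poch_pos (by linarith : 0 < m + 3 / 2) j).ne'
    have h3 : m + 1 / 2 ≠ 0 := by positivity
    rw [weightMoment_odd, show 2 * j + 1 + 1 = 2 * (j + 1) by ring, weightMoment_two_mul hm,
      poch_succ_left (1 / 2), poch_succ_left (m + 1 / 2), show (1 / 2 : ℝ) + 1 = 3 / 2 by norm_num,
      show m + 1 / 2 + 1 = m + 3 / 2 by ring, hypCoeff, hypCoeff]
    field_simp
    ring
end
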